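/- Let d ≥ 1, ℓ ≥ 1, ν ∈ ℝ^d and τ² > 0. For all variance vectors s, s' ∈ (0,∞)^ℓ with s ≠ s', one has ∫_{(ℝ^d)^ℓ} √( C(y, s) · C(y, s') ) dy < 1; equivalently, the squared Hellinger distance between the marginal observation densities C(·, s) and C(·, s') of one task under two distinct variance assignments is strictly positive. -/

import Mathlib

open MeasureTheory ProbabilityTheory Real

noncomputable section

/-- Density of the spherical Gaussian on `ℝ^d` with mean `m` and per-coordinate variance `s`:
`φ(x | m, s) = (2πs)^{-d/2} exp(-‖x-m‖²/(2s))`. -/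
def phi (d : ℕ) (x m : EuclideanSpace ℝ (Fin d)) (s : ℝ) : ℝ :=
  (2 * π * s) ^ (-(d : ℝ) / 2) * Real.exp (-‖x - m‖ ^ 2 / (2 * s))

/-- The spherical Gaussian measure on `ℝ^d` with mean `m` and per-coordinate variance `s`,
defined by its density w.r.t. Lebesgue measure. -/
def sphericalGaussian (d : ℕ) (m : EuclideanSpace ℝ (Fin d)) (s : ℝ) :
    Measure (EuclideanSpace ℝ (Fin d)) :=
  volume.withDensity fun x => ENNReal.ofReal (phi d x m s)

/-- Posterior variance `σ̄²(s) = (1/τ² + Σ_u 1/s_u)⁻¹`. -/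
def sbar (ℓ : ℕ) (τ2 : ℝ) (s : Fin ℓ → ℝ) : ℝ :=
  (1 / τ2 + ∑ u, 1 / s u)⁻¹

/-- Posterior mean `μ̄(y, s) = σ̄²(s) • (ν/τ² + Σ_u y_u/s_u)`. -/
def mubar (d ℓ : ℕ) (ν : EuclideanSpace ℝ (Fin d)) (τ2 : ℝ)
    (y : Fin ℓ → EuclideanSpace ℝ (Fin d)) (s : Fin ℓ → ℝ) : EuclideanSpace ℝ (Fin d) :=
  sbar ℓ τ2 s • ((1 / τ2) • ν + ∑ u, (1 / s u) • y u)

/-- Exponent `D(y,s) = (σ̄²(s)/2) (Σ_u ‖y_u-ν‖²/(s_u τ²) + Σ_{u<v} ‖y_u-y_v‖²/(s_u s_v))`. -/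
def Dfac (d ℓ : ℕ) (ν : EuclideanSpace ℝ (Fin d)) (τ2 : ℝ)
    (y : Fin ℓ → EuclideanSpace ℝ (Fin d)) (s : Fin ℓ → ℝ) : ℝ :=
  sbar ℓ τ2 s / 2 *
    (∑ u, ‖y u - ν‖ ^ 2 / (s u * τ2) +
      ∑ u, ∑ v, if u < v then ‖y u - y v‖ ^ 2 / (s u * s v) else 0)

/-- Normalization factor
`C(y,s) = (σ̄²(s) / (τ² ∏_u 2π s_u))^{d/2} exp(-D(y,s))`. -/
def Cfac (d ℓ : ℕ) (ν : EuclideanSpace ℝ (Fin d)) (τ2 : ℝ)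
    (y : Fin ℓ → EuclideanSpace ℝ (Fin d)) (s : Fin ℓ → ℝ) : ℝ :=
  (sbar ℓ τ2 s / (τ2 * ∏ u, (2 * π * s u))) ^ ((d : ℝ) / 2) *
    Real.exp (-Dfac d ℓ ν τ2 y s)

theorem sum_sum_eq_two_mul_sum_lt {ι : Type*} [Fintype ι] [LinearOrder ι] (f : ι → ι → ℝ)
    (hsymm : ∀ u v, f u v = f v u) (hdiag : ∀ u, f u u = 0) :
    ∑ u, ∑ v, f u v = 2 * ∑ u, ∑ v, if u < v then f u v else 0 := by
  have h : ∀ u v, f u v = (if u < v then f u v else 0) + (if v < u then f v u else 0) := by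
    intro u v
    rcases lt_trichotomy u v with h | h | h
    · simp [h, h.not_gt]
    · subst h
      simp [hdiag]
    · simp [h, h.not_gt, hsymm u v]
  calc ∑ u, ∑ v, f u v
      = ∑ u, ∑ v, ((if u < v then f u v else 0) + (if v < u then f v u else 0)) :=
        Finset.sum_congr rfl fun u _ => Finset.sum_congr rfl fun v _ => h u v
    _ = _ := by
        simp only [Finset.sum_add_distrib]
        rw [Finset.sum_comm (f := fun u v => if v < u then f v u else 0)]
        ring

theorem sum_sum_mul_norm_sub_sq {ι E : Type*} [Fintype ι] [NormedAddCommGroup E]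
    [InnerProductSpace ℝ E] (a : ι → ℝ) (x : ι → E) :
    ∑ u, ∑ v, a u * a v * ‖x u - x v‖ ^ 2 =
      2 * ((∑ u, a u) * ∑ u, a u * ‖x u‖ ^ 2) - 2 * ‖∑ u, a u • x u‖ ^ 2 := by
  have hB : ‖∑ u, a u • x u‖ ^ 2 = ∑ u, ∑ v, a u * a v * inner ℝ (x u) (x v) := by
    rw [← real_inner_self_eq_norm_sq, sum_inner]
    refine Finset.sum_congr rfl fun u _ => ?_
    rw [inner_sum]
    refine Finset.sum_congr rfl fun v _ => ?_
    rw [real_inner_smul_left, real_inner_smul_right]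
    ring
  have h1 : (∑ u, a u) * ∑ u, a u * ‖x u‖ ^ 2 = ∑ u, ∑ v, a u * (a v * ‖x v‖ ^ 2) :=
    Finset.sum_mul_sum _ _ _ _
  have h2 : (∑ u, a u) * ∑ u, a u * ‖x u‖ ^ 2 = ∑ u, ∑ v, a v * (a u * ‖x u‖ ^ 2) := by
    rw [h1, Finset.sum_comm]
  have h3 : 2 * ((∑ u, a u) * ∑ u, a u * ‖x u‖ ^ 2) =
      ∑ u, ∑ v, (a u * (a v * ‖x v‖ ^ 2) + a v * (a u * ‖x u‖ ^ 2)) := by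
    simp only [Finset.sum_add_distrib]
    rw [← h1, ← h2]
    ring
  rw [h3, hB, Finset.mul_sum, ← Finset.sum_sub_distrib]
  refine Finset.sum_congr rfl fun u _ => ?_
  rw [Finset.mul_sum, ← Finset.sum_sub_distrib]
  refine Finset.sum_congr rfl fun v _ => ?_
  rw [norm_sub_sq_real]
  ring

section Marginal

variable {d ℓ : ℕ} {τ2 : ℝ} {s : Fin ℓ → ℝ}

theorem precision_pos (hτ : 0 < τ2) (hs : ∀ u, 0 < s u) : 0 < 1 / τ2 + ∑ u, 1 / s u := by
  have : 0 ≤ ∑ u, 1 / s u := Finset.sum_nonneg fun u _ => (one_div_pos.2 (hs u)).le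
  positivity

theorem sbar_pos (hτ : 0 < τ2) (hs : ∀ u, 0 < s u) : 0 < sbar ℓ τ2 s :=
  inv_pos.2 (precision_pos hτ hs)

theorem two_mul_Dfac (ν : EuclideanSpace ℝ (Fin d)) (hτ : 0 < τ2) (hs : ∀ u, 0 < s u)
    (y : Fin ℓ → EuclideanSpace ℝ (Fin d)) :
    2 * Dfac d ℓ ν τ2 y s = ∑ u, 1 / s u * ‖y u - ν‖ ^ 2 -
      sbar ℓ τ2 s * ‖∑ u, (1 / s u) • (y u - ν)‖ ^ 2 := by
  have hW := precision_pos hτ hs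
  have h1 : ∑ u, ‖y u - ν‖ ^ 2 / (s u * τ2) = 1 / τ2 * ∑ u, 1 / s u * ‖y u - ν‖ ^ 2 := by
    rw [Finset.mul_sum]
    refine Finset.sum_congr rfl fun u _ => ?_
    have := (hs u).ne'
    field_simp
  have h2 := sum_sum_eq_two_mul_sum_lt (fun u v => ‖y u - y v‖ ^ 2 / (s u * s v))
    (fun u v => by rw [norm_sub_rev, mul_comm]) (fun u => by simp)
  have h3 := sum_sum_mul_norm_sub_sq (fun u => 1 / s u) (fun u => y u - ν)
  have h4 : ∑ u, ∑ v, ‖y u - y v‖ ^ 2 / (s u * s v) =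
      ∑ u, ∑ v, 1 / s u * (1 / s v) * ‖y u - ν - (y v - ν)‖ ^ 2 := by
    refine Finset.sum_congr rfl fun u _ => Finset.sum_congr rfl fun v _ => ?_
    rw [sub_sub_sub_cancel_right]
    have := (hs u).ne'
    have := (hs v).ne'
    field_simp
  rw [h4, h3] at h2
  unfold Dfac
  rw [h1]
  have h5 : sbar ℓ τ2 s * (1 / τ2 + ∑ u, 1 / s u) = 1 := inv_mul_cancel₀ hW.ne'
  linear_combination (-(1 / 2) * sbar ℓ τ2 s) * h2 +
    (∑ u, 1 / s u * ‖y u - ν‖ ^ 2) * h5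

theorem exponent_complete_square (ν θ : EuclideanSpace ℝ (Fin d)) (hτ : 0 < τ2)
    (hs : ∀ u, 0 < s u) (y : Fin ℓ → EuclideanSpace ℝ (Fin d)) :
    1 / τ2 * ‖θ - ν‖ ^ 2 + ∑ u, 1 / s u * ‖y u - θ‖ ^ 2 =
      (sbar ℓ τ2 s)⁻¹ * ‖θ - mubar d ℓ ν τ2 y s‖ ^ 2 + 2 * Dfac d ℓ ν τ2 y s := by
  have hS := sbar_pos hτ hs
  have hW := precision_pos hτ hs
  have hsinv : (sbar ℓ τ2 s)⁻¹ = 1 / τ2 + ∑ u, 1 / s u := inv_inv _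
  have hmean : θ - mubar d ℓ ν τ2 y s =
      (θ - ν) - sbar ℓ τ2 s • ∑ u, (1 / s u) • (y u - ν) := by
    have hν : sbar ℓ τ2 s • ((1 / τ2) • ν + (∑ u, 1 / s u) • ν) = ν := by
      rw [← add_smul, ← hsinv, smul_smul, mul_inv_cancel₀ hS.ne', one_smul]
    have hsum : ∑ u, (1 / s u) • (y u - ν) =
        ∑ u, (1 / s u) • y u - (∑ u, 1 / s u) • ν := by
      simp only [smul_sub, Finset.sum_sub_distrib, Finset.sum_smul]
    unfold mubar
    rw [hsum]
    nth_rewrite 2 [← hν]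
    simp only [smul_add, smul_sub]
    abel
  have hterm : ∑ u, 1 / s u * ‖y u - θ‖ ^ 2 = ∑ u, 1 / s u * ‖y u - ν‖ ^ 2 -
      2 * inner ℝ (θ - ν) (∑ u, (1 / s u) • (y u - ν)) + (∑ u, 1 / s u) * ‖θ - ν‖ ^ 2 := by
    rw [inner_sum, Finset.mul_sum, Finset.sum_mul, ← Finset.sum_sub_distrib,
      ← Finset.sum_add_distrib]
    refine Finset.sum_congr rfl fun u _ => ?_
    rw [← sub_sub_sub_cancel_right (y u) θ ν, norm_sub_sq_real, real_inner_smul_right,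
      real_inner_comm]
    ring
  rw [two_mul_Dfac ν hτ hs, hmean, hterm, norm_sub_sq_real (θ - ν), real_inner_smul_right, norm_smul,
    mul_pow, Real.norm_eq_abs, sq_abs]
  have h5 : (sbar ℓ τ2 s)⁻¹ * sbar ℓ τ2 s = 1 := inv_mul_cancel₀ hS.ne'
  linear_combination (-‖θ - ν‖ ^ 2) * hsinv +
    (2 * inner ℝ (θ - ν) (∑ u, (1 / s u) • (y u - ν)) -
      sbar ℓ τ2 s * ‖∑ u, (1 / s u) • (y u - ν)‖ ^ 2) * h5

theorem phi_nonneg (x m : EuclideanSpace ℝ (Fin d)) {v : ℝ} (hv : 0 < v) : 0 ≤ phi d x m v := by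
  unfold phi
  positivity

theorem integral_phi (m : EuclideanSpace ℝ (Fin d)) {v : ℝ} (hv : 0 < v) :
    ∫ x, phi d x m v = 1 := by
  have h := GaussianFourier.integral_rexp_neg_mul_sq_norm (V := EuclideanSpace ℝ (Fin d))
    (b := 1 / (2 * v)) (by positivity)
  unfold phi
  rw [integral_const_mul,
    integral_sub_right_eq_self (fun x : EuclideanSpace ℝ (Fin d) => rexp (-‖x‖ ^ 2 / (2 * v))) m]
  have h' : (fun x : EuclideanSpace ℝ (Fin d) => rexp (-‖x‖ ^ 2 / (2 * v))) =
      fun x => rexp (-(1 / (2 * v)) * ‖x‖ ^ 2) := by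
    ext x
    congr 1
    ring
  rw [h', h, finrank_euclideanSpace_fin, show π / (1 / (2 * v)) = 2 * π * v by field_simp,
    ← Real.rpow_add (by positivity)]
  simp [neg_div]

theorem integrable_phi (m : EuclideanSpace ℝ (Fin d)) {v : ℝ} (hv : 0 < v) :
    Integrable fun x => phi d x m v :=
  integrable_of_integral_eq_one (integral_phi m hv)

theorem lintegral_phi (m : EuclideanSpace ℝ (Fin d)) {v : ℝ} (hv : 0 < v) :
    ∫⁻ x, ENNReal.ofReal (phi d x m v) = 1 := by
  rw [← ofReal_integral_eq_lintegral_ofReal (integrable_phi m hv)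
    (Filter.Eventually.of_forall fun x => phi_nonneg x m hv), integral_phi m hv, ENNReal.ofReal_one]

theorem lintegral_prod_phi (θ : EuclideanSpace ℝ (Fin d)) (hs : ∀ u, 0 < s u) :
    ∫⁻ y : Fin ℓ → EuclideanSpace ℝ (Fin d), ENNReal.ofReal (∏ u, phi d (y u) θ (s u)) = 1 := by
  have hint : Integrable fun y : Fin ℓ → EuclideanSpace ℝ (Fin d) => ∏ u, phi d (y u) θ (s u) :=
    Integrable.fintype_prod (f := fun u x => phi d x θ (s u)) fun u => integrable_phi θ (hs u)
  rw [← ofReal_integral_eq_lintegral_ofReal hint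
    (Filter.Eventually.of_forall fun y => Finset.prod_nonneg fun u _ => phi_nonneg _ _ (hs u)),
    integral_fintype_prod_volume_eq_prod (fun u x => phi d x θ (s u))]
  simp [integral_phi θ (hs _)]

theorem phi_mul_prod_phi (ν θ : EuclideanSpace ℝ (Fin d)) (hτ : 0 < τ2) (hs : ∀ u, 0 < s u)
    (y : Fin ℓ → EuclideanSpace ℝ (Fin d)) :
    phi d θ ν τ2 * ∏ u, phi d (y u) θ (s u) =
      Cfac d ℓ ν τ2 y s * phi d θ (mubar d ℓ ν τ2 y s) (sbar ℓ τ2 s) := by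
  have hS := sbar_pos hτ hs
  have hP : 0 < ∏ u, (2 * π * s u) := Finset.prod_pos fun u _ => by
    have := hs u
    positivity
  have hpre : (2 * π * τ2) ^ (-(d : ℝ) / 2) * ∏ u, (2 * π * s u) ^ (-(d : ℝ) / 2) =
      (sbar ℓ τ2 s / (τ2 * ∏ u, (2 * π * s u))) ^ ((d : ℝ) / 2) *
        (2 * π * sbar ℓ τ2 s) ^ (-(d : ℝ) / 2) := by
    rw [Real.finsetProd_rpow _ _ (fun u _ => by have := hs u; positivity), neg_div,
      Real.rpow_neg (by positivity), Real.rpow_neg hP.le, Real.rpow_neg (by positivity),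
      ← Real.inv_rpow (by positivity), ← Real.inv_rpow hP.le, ← Real.inv_rpow (by positivity),
      ← Real.mul_rpow (by positivity) (by positivity),
      ← Real.mul_rpow (by positivity) (by positivity)]
    congr 1
    field_simp
  have hexp : rexp (-‖θ - ν‖ ^ 2 / (2 * τ2)) * ∏ u, rexp (-‖y u - θ‖ ^ 2 / (2 * s u)) =
      rexp (-Dfac d ℓ ν τ2 y s) *
        rexp (-‖θ - mubar d ℓ ν τ2 y s‖ ^ 2 / (2 * sbar ℓ τ2 s)) := by
    rw [← Real.exp_sum, ← Real.exp_add, ← Real.exp_add]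
    congr 1
    have h := exponent_complete_square ν θ hτ hs y
    have hsum : ∑ u, -‖y u - θ‖ ^ 2 / (2 * s u) =
        -(1 / 2) * ∑ u, 1 / s u * ‖y u - θ‖ ^ 2 := by
      rw [Finset.mul_sum]
      refine Finset.sum_congr rfl fun u _ => ?_
      ring
    rw [hsum]
    linear_combination (-(1 / 2)) * h
  unfold phi Cfac
  rw [Finset.prod_mul_distrib]
  linear_combination (rexp (-‖θ - ν‖ ^ 2 / (2 * τ2)) * ∏ u, rexp (-‖y u - θ‖ ^ 2 / (2 * s u))) *
    hpre + ((sbar ℓ τ2 s / (τ2 * ∏ u, (2 * π * s u))) ^ ((d : ℝ) / 2) *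
        (2 * π * sbar ℓ τ2 s) ^ (-(d : ℝ) / 2)) * hexp

theorem Cfac_prefactor_pos (hτ : 0 < τ2) (hs : ∀ u, 0 < s u) :
    0 < (sbar ℓ τ2 s / (τ2 * ∏ u, (2 * π * s u))) ^ ((d : ℝ) / 2) := by
  have hS := sbar_pos hτ hs
  have hP : 0 < ∏ u, (2 * π * s u) := Finset.prod_pos fun u _ => by
    have := hs u
    positivity
  positivity

theorem Cfac_pos (ν : EuclideanSpace ℝ (Fin d)) (hτ : 0 < τ2) (hs : ∀ u, 0 < s u)
    (y : Fin ℓ → EuclideanSpace ℝ (Fin d)) : 0 < Cfac d ℓ ν τ2 y s :=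
  mul_pos (Cfac_prefactor_pos hτ hs) (Real.exp_pos _)

theorem continuous_Cfac (ν : EuclideanSpace ℝ (Fin d)) (τ2 : ℝ) (s : Fin ℓ → ℝ) :
    Continuous fun y => Cfac d ℓ ν τ2 y s := by
  have h : ∀ u v : Fin ℓ, Continuous fun y : Fin ℓ → EuclideanSpace ℝ (Fin d) =>
      if u < v then ‖y u - y v‖ ^ 2 / (s u * s v) else 0 := by
    intro u v
    split_ifs <;> fun_prop
  unfold Cfac Dfac
  fun_prop

theorem continuous_phi_mul_prod_phi (ν : EuclideanSpace ℝ (Fin d)) (τ2 : ℝ) (s : Fin ℓ → ℝ) :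
    Continuous fun p : (Fin ℓ → EuclideanSpace ℝ (Fin d)) × EuclideanSpace ℝ (Fin d) =>
      phi d p.2 ν τ2 * ∏ u, phi d (p.1 u) p.2 (s u) := by
  unfold phi
  fun_prop

theorem lintegral_Cfac (ν : EuclideanSpace ℝ (Fin d)) (hτ : 0 < τ2) (hs : ∀ u, 0 < s u) :
    ∫⁻ y, ENNReal.ofReal (Cfac d ℓ ν τ2 y s) = 1 := by
  have hmeas : Measurable (Function.uncurry
      fun (y : Fin ℓ → EuclideanSpace ℝ (Fin d)) (θ : EuclideanSpace ℝ (Fin d)) =>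
        ENNReal.ofReal (phi d θ ν τ2 * ∏ u, phi d (y u) θ (s u))) :=
    (continuous_phi_mul_prod_phi ν τ2 s).measurable.ennreal_ofReal
  have hleft : ∀ y : Fin ℓ → EuclideanSpace ℝ (Fin d),
      ∫⁻ θ, ENNReal.ofReal (phi d θ ν τ2 * ∏ u, phi d (y u) θ (s u)) =
        ENNReal.ofReal (Cfac d ℓ ν τ2 y s) := fun y => by
    simp_rw [phi_mul_prod_phi ν _ hτ hs y, ENNReal.ofReal_mul (Cfac_pos ν hτ hs y).le]
    rw [lintegral_const_mul' _ _ ENNReal.ofReal_ne_top, lintegral_phi _ (sbar_pos hτ hs), mul_one]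
  have hright : ∀ θ : EuclideanSpace ℝ (Fin d),
      ∫⁻ y : Fin ℓ → EuclideanSpace ℝ (Fin d),
        ENNReal.ofReal (phi d θ ν τ2 * ∏ u, phi d (y u) θ (s u)) =
        ENNReal.ofReal (phi d θ ν τ2) := fun θ => by
    simp_rw [ENNReal.ofReal_mul (phi_nonneg θ ν hτ)]
    rw [lintegral_const_mul' _ _ ENNReal.ofReal_ne_top, lintegral_prod_phi θ hs, mul_one]
  rw [← lintegral_phi ν hτ, ← lintegral_congr hleft, ← lintegral_congr hright]
  exact lintegral_lintegral_swap hmeas.aemeasurable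

theorem integral_Cfac (ν : EuclideanSpace ℝ (Fin d)) (hτ : 0 < τ2) (hs : ∀ u, 0 < s u) :
    ∫ y, Cfac d ℓ ν τ2 y s = 1 := by
  rw [integral_eq_lintegral_of_nonneg_ae
    (Filter.Eventually.of_forall fun y => (Cfac_pos ν hτ hs y).le)
    (continuous_Cfac ν τ2 s).aestronglyMeasurable, lintegral_Cfac ν hτ hs, ENNReal.toReal_one]

theorem two_mul_Dfac_line (ν e : EuclideanSpace ℝ (Fin d)) (he : ‖e‖ = 1) (hτ : 0 < τ2)
    (hs : ∀ u, 0 < s u) (c : Fin ℓ → ℝ) :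
    2 * Dfac d ℓ ν τ2 (fun u => ν + c u • e) s =
      ∑ u, 1 / s u * c u ^ 2 - sbar ℓ τ2 s * (∑ u, 1 / s u * c u) ^ 2 := by
  rw [two_mul_Dfac ν hτ hs]
  simp only [add_sub_cancel_left, smul_smul, ← Finset.sum_smul, norm_smul, he, mul_one,
    Real.norm_eq_abs, sq_abs]

theorem eq_of_Dfac_eq {s' : Fin ℓ → ℝ} (hd : 1 ≤ d) (ν : EuclideanSpace ℝ (Fin d)) (hτ : 0 < τ2)
    (hs : ∀ u, 0 < s u) (hs' : ∀ u, 0 < s' u)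
    (h : ∀ y, Dfac d ℓ ν τ2 y s = Dfac d ℓ ν τ2 y s') : s = s' := by
  obtain ⟨e, he⟩ : ∃ e : EuclideanSpace ℝ (Fin d), ‖e‖ = 1 :=
    ⟨EuclideanSpace.single ⟨0, hd⟩ 1, by simp⟩
  have hline : ∀ c : Fin ℓ → ℝ,
      ∑ u, 1 / s u * c u ^ 2 - sbar ℓ τ2 s * (∑ u, 1 / s u * c u) ^ 2 =
      ∑ u, 1 / s' u * c u ^ 2 - sbar ℓ τ2 s' * (∑ u, 1 / s' u * c u) ^ 2 := fun c => by
    rw [← two_mul_Dfac_line ν e he hτ hs, ← two_mul_Dfac_line ν e he hτ hs', h]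
  have hS := sbar_pos hτ hs
  have hS' := sbar_pos hτ hs'
  have hW : sbar ℓ τ2 s * (1 / τ2 + ∑ u, 1 / s u) = 1 :=
    inv_mul_cancel₀ (precision_pos hτ hs).ne'
  have hW' : sbar ℓ τ2 s' * (1 / τ2 + ∑ u, 1 / s' u) = 1 :=
    inv_mul_cancel₀ (precision_pos hτ hs').ne'
  have hone := hline fun _ => 1
  simp only [one_pow, mul_one] at hone
  have hsbar : sbar ℓ τ2 s = sbar ℓ τ2 s' := by
    have ht : (1 / τ2) ^ 2 ≠ 0 := by positivity
    refine mul_left_cancel₀ ht ?_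
    linear_combination -hone +
      (1 / τ2 - ∑ u, 1 / s u) * hW - (1 / τ2 - ∑ u, 1 / s' u) * hW'
  funext u
  have hplus := hline fun v => 1 + Pi.single (M := fun _ => ℝ) u 1 v
  have hminus := hline fun v => 1 - Pi.single (M := fun _ => ℝ) u 1 v
  have hsum : ∀ r : Fin ℓ → ℝ, ∑ v, r v * Pi.single (M := fun _ => ℝ) u 1 v = r u := fun r => by
    simp [Pi.single_apply]
  have hsq : ∀ v, Pi.single (M := fun _ => ℝ) u 1 v ^ 2 = Pi.single (M := fun _ => ℝ) u 1 v :=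
    fun v => by by_cases hv : v = u <;> simp [hv]
  have hexp : ∀ (r : Fin ℓ → ℝ), ∑ v, r v * (1 + Pi.single (M := fun _ => ℝ) u 1 v) ^ 2 =
      ∑ v, r v + 3 * r u := fun r => by
    rw [← hsum r, Finset.mul_sum, ← Finset.sum_add_distrib]
    exact Finset.sum_congr rfl fun v _ => by linear_combination r v * hsq v
  have hexm : ∀ (r : Fin ℓ → ℝ), ∑ v, r v * (1 - Pi.single (M := fun _ => ℝ) u 1 v) ^ 2 =
      ∑ v, r v - r u := fun r => by
    rw [← hsum r, ← Finset.sum_sub_distrib]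
    exact Finset.sum_congr rfl fun v _ => by linear_combination r v * hsq v
  have hlin : ∀ (r : Fin ℓ → ℝ), ∑ v, r v * (1 + Pi.single (M := fun _ => ℝ) u 1 v) =
      ∑ v, r v + r u := fun r => by
    rw [← hsum r, ← Finset.sum_add_distrib]
    exact Finset.sum_congr rfl fun v _ => by ring
  have hlinm : ∀ (r : Fin ℓ → ℝ), ∑ v, r v * (1 - Pi.single (M := fun _ => ℝ) u 1 v) =
      ∑ v, r v - r u := fun r => by
    rw [← hsum r, ← Finset.sum_sub_distrib]
    exact Finset.sum_congr rfl fun v _ => by ring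
  rw [hexp fun v => 1 / s v, hexp fun v => 1 / s' v, hlin fun v => 1 / s v,
    hlin fun v => 1 / s' v] at hplus
  rw [hexm fun v => 1 / s v, hexm fun v => 1 / s' v, hlinm fun v => 1 / s v,
    hlinm fun v => 1 / s' v] at hminus
  have hinv : 1 / s u = 1 / s' u := by
    have ht : sbar ℓ τ2 s * (1 / τ2) ≠ 0 := by positivity
    refine mul_left_cancel₀ ht ?_
    linear_combination (1 / 4) * hplus - (1 / 4) * hminus + (1 / s u) * hW - (1 / s' u) * hW' -
      (1 / τ2) * (1 / s' u) * hsbar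
  simpa using hinv

theorem exists_Cfac_ne {s' : Fin ℓ → ℝ} (hd : 1 ≤ d) (ν : EuclideanSpace ℝ (Fin d)) (hτ : 0 < τ2)
    (hs : ∀ u, 0 < s u) (hs' : ∀ u, 0 < s' u) (hne : s ≠ s') :
    ∃ y, Cfac d ℓ ν τ2 y s ≠ Cfac d ℓ ν τ2 y s' := by
  by_contra! h
  refine hne (eq_of_Dfac_eq hd ν hτ hs hs' fun y => ?_)
  have hpre := h fun _ => ν
  have hy := h y
  have hK := Cfac_prefactor_pos (d := d) hτ hs'
  unfold Cfac at hpre hy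
  simp only [Dfac, sub_self, norm_zero, ne_eq, OfNat.ofNat_ne_zero, not_false_eq_true, zero_pow,
    zero_div, ite_self, Finset.sum_const_zero, add_zero, mul_zero, neg_zero, Real.exp_zero,
    mul_one] at hpre
  rw [hpre] at hy
  exact neg_injective (Real.exp_injective (mul_left_cancel₀ hK.ne' hy))

end Marginal

theorem integral_sqrt_mul_lt_one {X : Type*} [TopologicalSpace X] [MeasurableSpace X]
    [OpensMeasurableSpace X] {μ : Measure X} [μ.IsOpenPosMeasure] {f g : X → ℝ}
    (hf : Continuous f) (hg : Continuous g) (hf0 : ∀ x, 0 ≤ f x) (hg0 : ∀ x, 0 ≤ g x)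
    (hf1 : ∫ x, f x ∂μ = 1) (hg1 : ∫ x, g x ∂μ = 1) (hne : ∃ x, f x ≠ g x) :
    ∫ x, √(f x * g x) ∂μ < 1 := by
  obtain ⟨x, hx⟩ := hne
  have hfi := integrable_of_integral_eq_one hf1
  have hgi := integrable_of_integral_eq_one hg1
  have hsq : ∀ x, (√(f x) - √(g x)) ^ 2 = f x + g x - 2 * √(f x * g x) := fun x => by
    rw [Real.sqrt_mul (hf0 x), sub_sq, Real.sq_sqrt (hf0 x), Real.sq_sqrt (hg0 x)]
    ring
  have hcont : Continuous fun x => √(f x * g x) := by fun_prop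
  have hint : Integrable (fun x => √(f x * g x)) μ := by
    refine (hfi.add hgi).mono' hcont.measurable.aestronglyMeasurable
      (Filter.Eventually.of_forall fun x => ?_)
    have h1 := hsq x
    have h2 := sq_nonneg (√(f x) - √(g x))
    rw [Real.norm_of_nonneg (Real.sqrt_nonneg _), Pi.add_apply]
    linarith [Real.sqrt_nonneg (f x * g x), hf0 x, hg0 x]
  have hpos : 0 < ∫ x, (f x + g x - 2 * √(f x * g x)) ∂μ := by
    refine integral_pos_of_integrable_nonneg_nonzero (x := x) (by fun_prop)
      ((hfi.add hgi).sub (hint.const_mul 2)) (fun x => ?_) ?_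
    · rw [Pi.zero_apply, ← hsq]
      positivity
    · rw [← hsq]
      exact pow_ne_zero 2 (sub_ne_zero.2 fun h => hx ((Real.sqrt_inj (hf0 x) (hg0 x)).1 h))
  have hfgi : Integrable (fun x => f x + g x) μ := hfi.add hgi
  rw [integral_sub hfgi (hint.const_mul 2), integral_add hfi hgi, integral_const_mul, hf1,
    hg1] at hpos
  linarith

/-- for distinct variance vectors `s ≠ s'`, the Bhattacharyya coefficient
between the marginal observation densities `C(·,s)` and `C(·,s')` of one task is strictly
less than `1`, i.e. their squared Hellinger distance is strictly positive. -/
theorem statement13 (d ℓ : ℕ) (hd : 1 ≤ d) (hℓ : 1 ≤ ℓ)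
    (ν : EuclideanSpace ℝ (Fin d)) (τ2 : ℝ) (hτ : 0 < τ2)
    (s s' : Fin ℓ → ℝ) (hs : ∀ u, 0 < s u) (hs' : ∀ u, 0 < s' u) (hne : s ≠ s') :
    ∫ y : Fin ℓ → EuclideanSpace ℝ (Fin d),
      Real.sqrt (Cfac d ℓ ν τ2 y s * Cfac d ℓ ν τ2 y s') < 1 := by
  exact integral_sqrt_mul_lt_one (continuous_Cfac ν τ2 s) (continuous_Cfac ν τ2 s')
    (fun y => (Cfac_pos ν hτ hs y).le) (fun y => (Cfac_pos ν hτ hs' y).le)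
    (integral_Cfac ν hτ hs) (integral_Cfac ν hτ hs') (exists_Cfac_ne hd ν hτ hs hs' hne)
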